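/- Let N ≥ 21 and let ℓ ≥ 2 be the integer determined by 5·2^ℓ < N ≤ 5·2^{ℓ+1}. Suppose M is a positive integer with M ≤ ⌊√(2^{ℓ+2} − 1)⌋ + 1 and f : F_2^M → F_2 satisfies t_{(j+M)^2} = f(t_{j^2}, …, t_{(j+M−1)^2}) for all 0 ≤ j ≤ N − M − 1. Then t_{(2^ℓ + 2^{ℓ+1})^2} = t_{(2^ℓ + 2^{ℓ+2})^2}. -/

import Mathlib

/-- `patternCount k n` is the number of indices `i ≥ 0` such that the binary digits of `n`
in positions `i, i+1, …, i+k-1` are all equal to `1`. For `k = 1` this is the binary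
digit sum `s₁(n)`. -/
noncomputable def patternCount (k n : ℕ) : ℕ := {i : ℕ | ∀ j < k, n.testBit (i + j)}.ncard

/-- The Thue–Morse sequence over `F₂`: `t n ≡ s₁(n) (mod 2)`. -/
noncomputable def thueMorse (n : ℕ) : ZMod 2 := (patternCount 1 n : ZMod 2)

/-- The pattern sequence `P_k` over `F₂`: `p n ≡ s_k(n) (mod 2)`. -/
noncomputable def patternSeq (k n : ℕ) : ZMod 2 := (patternCount k n : ZMod 2)

theorem finite_setOf_testBit (n : ℕ) : {i : ℕ | n.testBit i}.Finite := by
  refine (Set.finite_Iio n).subset fun i hi => ?_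
  exact Nat.lt_two_pow_self.trans_le (Nat.ge_two_pow_of_testBit hi)

theorem patternCount_one (n : ℕ) : patternCount 1 n = {i : ℕ | n.testBit i}.ncard := by
  simp [patternCount]

theorem patternCount_one_two_pow_mul_add (k a : ℕ) {b : ℕ} (hb : b < 2 ^ k) :
    patternCount 1 (2 ^ k * a + b) = patternCount 1 a + patternCount 1 b := by
  have hlt {i : ℕ} (hi : b.testBit i) : i < k :=
    (Nat.pow_lt_pow_iff_right one_lt_two).1 ((Nat.ge_two_pow_of_testBit hi).trans_lt hb)
  have hset : {i : ℕ | (2 ^ k * a + b).testBit i} =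
      (fun i => i + k) '' {i : ℕ | a.testBit i} ∪ {i : ℕ | b.testBit i} := by
    ext i
    simp only [Set.mem_ofPred_eq, Set.mem_union, Set.mem_image,
      Nat.testBit_two_pow_mul_add a hb]
    split_ifs with h
    · exact ⟨Or.inr, fun h' => h'.resolve_left (by rintro ⟨j, -, rfl⟩; omega)⟩
    · refine ⟨fun h' => Or.inl ⟨i - k, h', by omega⟩, ?_⟩
      rintro (⟨j, hj, rfl⟩ | h')
      · simpa using hj
      · exact absurd (hlt h') h
  rw [patternCount_one, patternCount_one, patternCount_one, hset,
    Set.ncard_union_eq ?_ ((finite_setOf_testBit a).image _) (finite_setOf_testBit b),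
    Set.ncard_image_of_injective _ (add_left_injective k)]
  rw [Set.disjoint_left]
  rintro _ ⟨j, -, rfl⟩ h'
  exact absurd (hlt h') (Nat.le_add_left k j).not_gt

theorem thueMorse_two_pow_mul_add (k a : ℕ) {b : ℕ} (hb : b < 2 ^ k) :
    thueMorse (2 ^ k * a + b) = thueMorse a + thueMorse b := by
  simp [thueMorse, patternCount_one_two_pow_mul_add k a hb]

/-- If the binary expansions of `2 ^ (2 * m + 2)`, `2 ^ (m + 2) * i` and `i ^ 2` do not overlap,
the value of the Thue–Morse sequence at `(2 ^ (m + 1) + i) ^ 2` does not depend on `m`. -/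
theorem thueMorse_two_pow_add_sq {m i : ℕ} (hsq : i ^ 2 < 2 ^ (m + 2)) (hi : i < 2 ^ m) :
    thueMorse ((2 ^ (m + 1) + i) ^ 2) = thueMorse 1 + thueMorse i + thueMorse (i ^ 2) := by
  have h : (2 ^ (m + 1) + i) ^ 2 = 2 ^ (m + 2) * (2 ^ m * 1 + i) + i ^ 2 := by ring
  rw [h, thueMorse_two_pow_mul_add _ _ hsq, thueMorse_two_pow_mul_add _ _ hi]

/-- Two equal windows of a sequence satisfying a recurrence of order `M` continue equally. -/
theorem eq_of_recurrence_of_window_eq {α : Type*} {u : ℕ → α} {M N a b : ℕ}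
    {f : (Fin M → α) → α}
    (hrec : ∀ j, j + M + 1 ≤ N → u (j + M) = f fun r => u (j + r.val)) (hab : a ≤ b)
    (hwin : ∀ i < M, u (a + i) = u (b + i)) (i : ℕ) (hi : b + i < N) :
    u (a + i) = u (b + i) := by
  induction i using Nat.strong_induction_on with
  | _ i ih =>
    rcases lt_or_ge i M with h | h
    · exact hwin i h
    · obtain ⟨c, rfl⟩ := Nat.exists_eq_add_of_le' h
      rw [← add_assoc, ← add_assoc, hrec _ (by omega), hrec _ (by omega)]
      congr 1
      funext r
      have := r.isLt
      rw [add_assoc, add_assoc]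
      exact ih _ (by omega) (by omega)

theorem thueMorse_squares_recurrence_contradiction_setup (N ℓ : ℕ)
    (hN : 21 ≤ N) (hℓ : 2 ≤ ℓ) (hNl : 5 * 2 ^ ℓ < N) (hNu : N ≤ 5 * 2 ^ (ℓ + 1))
    (M : ℕ) (hM : 0 < M) (hMle : M ≤ Nat.sqrt (2 ^ (ℓ + 2) - 1) + 1)
    (f : (Fin M → ZMod 2) → ZMod 2)
    (hrec : ∀ j : ℕ, j + M + 1 ≤ N →
      thueMorse ((j + M) ^ 2) = f (fun r => thueMorse ((j + r.val) ^ 2))) :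
    thueMorse ((2 ^ ℓ + 2 ^ (ℓ + 1)) ^ 2) = thueMorse ((2 ^ ℓ + 2 ^ (ℓ + 2)) ^ 2) := by
  rw [add_comm (2 ^ ℓ), add_comm (2 ^ ℓ)]
  refine eq_of_recurrence_of_window_eq (u := fun n => thueMorse (n ^ 2)) hrec
    (Nat.pow_le_pow_right two_pos (by omega)) (fun i hi => ?_) _ (by rw [pow_add]; omega)
  have hsq : i ^ 2 < 2 ^ (ℓ + 2) := by
    have h := Nat.le_sqrt'.1 (show i ≤ Nat.sqrt (2 ^ (ℓ + 2) - 1) by omega)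
    have := Nat.two_pow_pos (ℓ + 2)
    omega
  have hlt : i < 2 ^ ℓ := by
    refine lt_of_pow_lt_pow_left₀ 2 (Nat.zero_le _) (hsq.trans_le ?_)
    rw [← pow_mul]
    exact Nat.pow_le_pow_right two_pos (by omega)
  change thueMorse ((2 ^ (ℓ + 1) + i) ^ 2) = thueMorse ((2 ^ (ℓ + 1 + 1) + i) ^ 2)
  rw [thueMorse_two_pow_add_sq hsq hlt, thueMorse_two_pow_add_sq
    (hsq.trans (Nat.pow_lt_pow_right one_lt_two (by omega)))
    (hlt.trans (Nat.pow_lt_pow_right one_lt_two (by omega)))]
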